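/- Let P = Theta x (0, l) be a cylinder in R^3 where Theta is a bounded C^2 planar domain and l > 0. Let v = (u1, u2, u3) : P -> R^3 be a harmonic vector field with div v = 0 in P and v = 0 on the bottom face Theta x {0} (in a sufficiently smooth sense). Then the third component u3 vanishes identically in P. -/

import Mathlib

open Set

/-- Second directional derivative of `f : ℝ³ → ℝ` in direction `v` (applied twice). -/
noncomputable def d2₃ (f : ℝ × ℝ × ℝ → ℝ) (v : ℝ × ℝ × ℝ) (p : ℝ × ℝ × ℝ) : ℝ :=
  fderiv ℝ (fun q => fderiv ℝ f q v) p v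

open MeasureTheory Metric

section KernelAverage

variable {E : Type*} [NormedAddCommGroup E] [NormedSpace ℝ E] [MeasurableSpace E]

/-- The average of `g` around `x` against the kernel `φ`, dilated by the factor `r`. -/
noncomputable def kernelAverage (μ : Measure E) (φ : E → ℝ) (r : ℝ) (g : E → ℝ) (x : E) : ℝ :=
  ∫ y, φ y * g (x - r • y) ∂μ

variable {μ : Measure E} {φ ψ g : E → ℝ} {r : ℝ}

lemma continuous_kernelAverage [BorelSpace E] [FiniteDimensional ℝ E] [IsFiniteMeasureOnCompacts μ]
    (hφ : Continuous φ) (hc : HasCompactSupport φ)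
    (hg : Continuous g) : Continuous (kernelAverage μ φ r g) := by
  rw [← continuousOn_univ]
  refine continuousOn_integral_of_compact_support (k := tsupport φ) hc ?_ ?_
  · apply Continuous.continuousOn
    simp only [Function.uncurry_def]
    fun_prop
  · intro p y _ hy
    simp [image_eq_zero_of_notMem_tsupport hy]

lemma abs_kernelAverage_le [BorelSpace E] [IsFiniteMeasureOnCompacts μ] (hφ : Continuous φ)
    (hc : HasCompactSupport φ) {M : ℝ} (hM : ∀ x, |g x| ≤ M) (x : E) :
    |kernelAverage μ φ r g x| ≤ (∫ y, |φ y| ∂μ) * M := by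
  rw [← integral_mul_const]
  refine norm_integral_le_of_norm_le (f := fun y => φ y * g (x - r • y)) ?_ (ae_of_all _ fun y => ?_)
  · exact ((hφ.integrable_of_hasCompactSupport hc).abs).mul_const M
  · rw [Real.norm_eq_abs, abs_mul]
    exact mul_le_mul_of_nonneg_left (hM _) (abs_nonneg _)

lemma kernelAverage_congr (hφ : ∀ y, 1 < ‖y‖ → φ y = 0) {g₁ g₂ : E → ℝ} (hr : 0 ≤ r) {x : E}
    (h : ∀ z ∈ closedBall x r, g₁ z = g₂ z) :
    kernelAverage μ φ r g₁ x = kernelAverage μ φ r g₂ x := by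
  refine integral_congr_ae (ae_of_all _ fun y => ?_)
  by_cases hy : 1 < ‖y‖
  · simp [hφ y hy]
  · have : x - r • y ∈ closedBall x r := by
      rw [mem_closedBall, dist_eq_norm, sub_sub_cancel_left, norm_neg, norm_smul,
        Real.norm_of_nonneg hr]
      exact mul_le_of_le_one_right hr (not_lt.1 hy)
    simp [h _ this]

lemma kernelAverage_const_mul (a : ℝ) (x : E) :
    kernelAverage μ φ r (fun z => a * g z) x = a * kernelAverage μ φ r g x := by
  simp only [kernelAverage, ← integral_const_mul]
  congr 1; ext y; ring

lemma kernelAverage_comm [BorelSpace E] [FiniteDimensional ℝ E] [IsFiniteMeasureOnCompacts μ]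
    (hφ : Continuous φ) (hc : HasCompactSupport φ)
    (hψ : Continuous ψ) (hd : HasCompactSupport ψ) (hg : Continuous g) (x : E) :
    kernelAverage μ φ r (kernelAverage μ ψ r g) x
      = kernelAverage μ ψ r (kernelAverage μ φ r g) x := by
  simp only [kernelAverage, ← integral_const_mul]
  rw [integral_integral_swap_of_hasCompactSupport]
  · congr 1; ext y; congr 1; ext z
    rw [sub_right_comm]; ring
  · simp only [Function.uncurry_def]; fun_prop
  · refine HasCompactSupport.of_support_subset_isCompact (K := tsupport φ ×ˢ tsupport ψ)
      (hc.prod hd) ?_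
    rintro ⟨y, z⟩ h
    simp only [Function.uncurry_def, Function.mem_support, ne_eq, mul_eq_zero, not_or] at h
    exact ⟨subset_tsupport _ h.1, subset_tsupport _ h.2.1⟩

lemma hasDerivAt_kernelAverage [BorelSpace E] [FiniteDimensional ℝ E] [μ.IsAddHaarMeasure]
    (hφ : ContDiff ℝ 1 φ) (hc : HasCompactSupport φ) (hg : Continuous g) (hr : 0 < r)
    (x e : E) (t : ℝ) :
    HasDerivAt (fun t : ℝ => kernelAverage μ φ r g (x + t • e))
      (r⁻¹ * kernelAverage μ (fun y => fderiv ℝ φ y e) r g (x + t • e)) t := by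
  have hr' : r ≠ 0 := hr.ne'
  have key : ∀ (κ : E → ℝ) (x : E), kernelAverage μ κ r g x
      = |(r ^ Module.finrank ℝ E)⁻¹| * ∫ y, κ (r⁻¹ • y) * g (x - y) ∂μ := by
    intro κ x
    have := Measure.integral_comp_smul μ (fun y => κ (r⁻¹ • y) * g (x - y)) r
    simpa [kernelAverage, smul_smul, hr'] using this
  set K : E → ℝ := fun y => φ (r⁻¹ • y) with hK
  have hK1 : ContDiff ℝ 1 K := hφ.comp (contDiff_const_smul _)
  have hKc : HasCompactSupport K := hc.comp_smul (inv_ne_zero hr')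
  have hconv := hKc.hasFDerivAt_convolution_left (ContinuousLinearMap.mul ℝ ℝ) hK1
    (hg.locallyIntegrable (μ := μ))
  have hline : HasDerivAt (fun t : ℝ => x + t • e) e t := by
    simpa using ((hasDerivAt_id t).smul_const e).const_add x
  have h1 := ((hconv (x + t • e)).comp_hasDerivAt t hline).const_mul |(r ^ Module.finrank ℝ E)⁻¹|
  have h2 : (fun t : ℝ => kernelAverage μ φ r g (x + t • e)) = fun t =>
      |(r ^ Module.finrank ℝ E)⁻¹| *
        ((convolution K g (ContinuousLinearMap.mul ℝ ℝ) μ) ∘ fun t : ℝ => x + t • e) t := by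
    ext t
    rw [key]; rfl
  rw [h2]
  refine h1.congr_deriv ?_
  symm
  rw [key, convolution, ContinuousLinearMap.integral_apply, ← mul_assoc, mul_comm r⁻¹, mul_assoc,
    ← integral_const_mul]
  · congr 2; ext y
    simp only [ContinuousLinearMap.precompL_apply, ContinuousLinearMap.mul_apply', hK,
      fderiv_comp_smul, _root_.smul_apply, smul_eq_mul]
    ring
  · have := (hKc.fderiv ℝ).convolutionExists_left
      ((ContinuousLinearMap.mul ℝ ℝ).precompL E) (hK1.continuous_fderiv one_ne_zero)
      (hg.locallyIntegrable (μ := μ)) (x + t • e)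
    exact this

end KernelAverage

section Uniqueness

open Filter Topology

lemma abs_le_mul_pow_div_factorial {k : ℕ} {F : ℕ → ℝ → ℝ} {T B : ℝ}
    (hF : ∀ j < k, ∀ t ∈ Icc 0 T, HasDerivAt (F j) (F (j + 1) t) t)
    (h0 : ∀ j < k, F j 0 = 0) (hB : ∀ t ∈ Icc 0 T, |F k t| ≤ B) :
    ∀ t ∈ Icc 0 T, |F 0 t| ≤ B * (t ^ k / k.factorial) := by
  induction k generalizing F with
  | zero => simpa using hB
  | succ k ih =>
    have h1 := ih (F := fun j => F (j + 1)) (fun j hj => hF (j + 1) (by omega))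
      (fun j hj => h0 (j + 1) (by omega)) hB
    refine image_norm_le_of_norm_deriv_right_le_deriv_boundary
      (B' := fun t => B * (t ^ k / k.factorial))
      (fun t ht => (hF 0 k.succ_pos t ht).continuousAt.continuousWithinAt)
      (fun t ht => (hF 0 k.succ_pos t (Ico_subset_Icc_self ht)).hasDerivWithinAt)
      (by simp [h0 0 k.succ_pos]) (fun t => ?_) (fun t ht => h1 t (Ico_subset_Icc_self ht))
    refine (((hasDerivAt_pow (k + 1) t).div_const ((k + 1).factorial : ℝ)).const_mul
      B).congr_deriv ?_
    have : (k.factorial : ℝ) ≠ 0 := by positivity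
    rw [Nat.factorial_succ]
    push_cast
    field_simp

variable {E : Type*} [NormedAddCommGroup E] [NormedSpace ℝ E] [FiniteDimensional ℝ E]
  [MeasurableSpace E] [BorelSpace E] {μ : Measure E} [μ.IsAddHaarMeasure]

lemma abs_le_of_kernelAverage_eq {φ g : E → ℝ} (hφ : ContDiff ℝ 1 φ)
    (hsupp : ∀ y, 1 < ‖y‖ → φ y = 0) (hc : 0 < ∫ y, φ y ∂μ) {e q : E} (he : ‖e‖ ≤ 1)
    (hg : Continuous g) {M R : ℝ} (hM : ∀ x, |g x| ≤ M) (hR : 0 < R)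
    (hmean : ∀ x r, 0 < r → closedBall x r ⊆ ball q R →
      kernelAverage μ φ r g x = (∫ y, φ y ∂μ) * g x)
    (hq : ∀ᶠ x in 𝓝 q, g x = 0) {k : ℕ} (hk : 0 < k) {t : ℝ} (ht : 0 ≤ t) (htR : t < R / 2) :
    |g (q + t • e)| ≤ ((2 * k / R) * ((∫ y, |fderiv ℝ φ y e| ∂μ) / ∫ y, φ y ∂μ)) ^ k * M *
      (t ^ k / k.factorial) := by
  set c := ∫ y, φ y ∂μ with hcdef
  set A := ∫ y, |fderiv ℝ φ y e| ∂μ with hA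
  have hk' : (0 : ℝ) < k := by exact_mod_cast hk
  set r : ℝ := R / (2 * k) with hr
  have hr0 : 0 < r := by positivity
  set ψ : E → ℝ := fun y => fderiv ℝ φ y e with hψ
  have hφc : HasCompactSupport φ :=
    HasCompactSupport.intro (isCompact_closedBall (0 : E) 1) fun y hy =>
      hsupp y (by simpa using hy)
  have hψcont : Continuous ψ := (hφ.continuous_fderiv one_ne_zero).clm_apply continuous_const
  have hψsupp : ∀ y, 1 < ‖y‖ → ψ y = 0 := by
    intro y hy
    have : φ =ᶠ[𝓝 y] fun _ => 0 := by
      filter_upwards [(isOpen_lt continuous_const continuous_norm).mem_nhds hy] with z hz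
      exact hsupp z hz
    simp [hψ, this.fderiv_eq]
  have hψc : HasCompactSupport ψ :=
    HasCompactSupport.intro (isCompact_closedBall (0 : E) 1) fun y hy =>
      hψsupp y (by simpa using hy)
  let G : ℕ → E → ℝ := fun j =>
    Nat.rec g (fun _ h x => (r⁻¹ * c⁻¹) * kernelAverage μ ψ r h x) j
  have hGsucc : ∀ j x, G (j + 1) x = (r⁻¹ * c⁻¹) * kernelAverage μ ψ r (G j) x :=
    fun _ _ => rfl
  have hGcont : ∀ j, Continuous (G j) := by
    intro j
    induction j with
    | zero => exact hg
    | succ j ih => exact continuous_const.mul (continuous_kernelAverage hψcont hψc ih)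
  have hGbound : ∀ j x, |G j x| ≤ (r⁻¹ * c⁻¹ * A) ^ j * M := by
    intro j
    induction j with
    | zero =>
      intro x
      rw [pow_zero, one_mul]
      exact hM x
    | succ j ih =>
      intro x
      rw [hGsucc, abs_mul, abs_of_pos (by positivity : 0 < r⁻¹ * c⁻¹)]
      calc _ ≤ (r⁻¹ * c⁻¹) * (A * ((r⁻¹ * c⁻¹ * A) ^ j * M)) := by
            gcongr
            exact abs_kernelAverage_le hψcont hψc ih x
        _ = _ := by ring
  have hsub : ∀ (j : ℕ) (x : E), x ∈ ball q (R - (j + 1 : ℕ) * r) →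
      closedBall x r ⊆ ball q (R - j * r) := by
    intro j x hx
    refine closedBall_subset_ball' ?_
    rw [mem_ball] at hx
    push_cast at hx
    linarith
  have hGmean : ∀ (j : ℕ), ∀ x ∈ ball q (R - (j + 1 : ℕ) * r),
      kernelAverage μ φ r (G j) x = c * G j x := by
    intro j
    induction j with
    | zero =>
      intro x hx
      refine hmean x r hr0 ?_
      simpa using hsub 0 x hx
    | succ j ih =>
      intro x hx
      rw [show G (j + 1) = fun x => (r⁻¹ * c⁻¹) * kernelAverage μ ψ r (G j) x from rfl,
        kernelAverage_const_mul]
      rw [kernelAverage_comm hφ.continuous hφc hψcont hψc (hGcont j),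
        kernelAverage_congr hψsupp hr0.le (g₂ := fun z => c * G j z)
          (fun z hz => ih z (hsub (j + 1) x hx hz)), kernelAverage_const_mul]
      ring
  have hGderiv : ∀ (j : ℕ) (x : E) (s : ℝ), x + s • e ∈ ball q (R - (j + 1 : ℕ) * r) →
      HasDerivAt (fun s : ℝ => G j (x + s • e)) (G (j + 1) (x + s • e)) s := by
    intro j x s hx
    have h1 := (hasDerivAt_kernelAverage hφ hφc (hGcont j) hr0 (μ := μ) x e s).const_mul c⁻¹
    have h2 : (fun s : ℝ => G j (x + s • e)) =ᶠ[𝓝 s]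
        fun s => c⁻¹ * kernelAverage μ φ r (G j) (x + s • e) := by
      have hcont : Continuous fun s : ℝ => x + s • e := by fun_prop
      filter_upwards [hcont.continuousAt.preimage_mem_nhds (isOpen_ball.mem_nhds hx)] with s hs
      rw [hGmean j _ hs, inv_mul_cancel_left₀ hc.ne']
    refine (h1.congr_of_eventuallyEq h2).congr_deriv ?_
    rw [hGsucc]
    ring
  have hhalf : ∀ j < k, ball q (R / 2) ⊆ ball q (R - (j + 1 : ℕ) * r) := by
    intro j hj
    refine ball_subset_ball ?_
    have h1 : ((j + 1 : ℕ) : ℝ) ≤ k := by exact_mod_cast hj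
    have h2 : (k : ℝ) * r = R / 2 := by rw [hr]; field_simp
    nlinarith
  have hGzero : ∀ j < k, ∀ᶠ x in 𝓝 q, G j x = 0 := by
    intro j
    induction j with
    | zero => exact fun _ => hq
    | succ j ih =>
      intro hj
      filter_upwards [(ih (by omega)).eventually_nhds, ball_mem_nhds q (half_pos hR)] with x hx hxb
      have h1 := hGderiv j x 0 (by simpa using hhalf j (by omega) hxb)
      have h2 : (fun s : ℝ => G j (x + s • e)) =ᶠ[𝓝 0] fun _ => 0 := by
        have hcont : Tendsto (fun s : ℝ => x + s • e) (𝓝 0) (𝓝 x) := by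
          have : Continuous fun s : ℝ => x + s • e := by fun_prop
          simpa using this.tendsto 0
        exact hcont.eventually hx
      simpa using h1.unique ((hasDerivAt_const (0 : ℝ) (0 : ℝ)).congr_of_eventuallyEq h2)
  have hline : ∀ s ∈ Icc 0 t, q + s • e ∈ ball q (R / 2) := by
    intro s hs
    rw [mem_ball, dist_eq_norm, add_sub_cancel_left, norm_smul, Real.norm_of_nonneg hs.1]
    calc s * ‖e‖ ≤ s * 1 := mul_le_mul_of_nonneg_left he hs.1
      _ < R / 2 := by linarith [hs.2]
  have := abs_le_mul_pow_div_factorial (k := k) (T := t) (F := fun j s => G j (q + s • e))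
    (fun j hj s hs => hGderiv j q s (hhalf j hj (hline s hs)))
    (fun j hj => by simpa using (hGzero j hj).self_of_nhds)
    (fun s _ => hGbound k _) t ⟨ht, le_rfl⟩
  have hrat : r⁻¹ * c⁻¹ * A = (2 * k / R) * (A / c) := by
    rw [hr]
    field_simp
  rw [hrat] at this
  exact this

lemma eq_zero_of_kernelAverage_eq {φ g : E → ℝ} (hφ : ContDiff ℝ 1 φ)
    (hsupp : ∀ y, 1 < ‖y‖ → φ y = 0) (hc : 0 < ∫ y, φ y ∂μ) {e q : E} (he : ‖e‖ ≤ 1)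
    (hg : Continuous g) {M R : ℝ} (hM : ∀ x, |g x| ≤ M) (hR : 0 < R)
    (hmean : ∀ x r, 0 < r → closedBall x r ⊆ ball q R →
      kernelAverage μ φ r g x = (∫ y, φ y ∂μ) * g x)
    (hq : ∀ᶠ x in 𝓝 q, g x = 0) {t : ℝ} (ht : 0 ≤ t)
    (htR : t ≤ (∫ y, φ y ∂μ) / (12 * ((∫ y, |fderiv ℝ φ y e| ∂μ) + ∫ y, φ y ∂μ)) * R) :
    g (q + t • e) = 0 := by
  have key := fun k hk htR => abs_le_of_kernelAverage_eq hφ hsupp hc he hg hM hR hmean hq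
    (k := k) hk ht htR
  set c := ∫ y, φ y ∂μ with hcdef
  set A := ∫ y, |fderiv ℝ φ y e| ∂μ with hA
  have hA0 : 0 ≤ A := integral_nonneg fun _ => abs_nonneg _
  have hM0 : 0 ≤ M := (abs_nonneg _).trans (hM q)
  have h12 : t * (12 * (A + c)) ≤ c * R := by
    rw [div_mul_eq_mul_div, le_div_iff₀ (by positivity)] at htR
    exact htR
  have ht2 : t < R / 2 := by
    have : c * (12 * t) ≤ c * R := by nlinarith [mul_nonneg ht hA0]
    have := le_of_mul_le_mul_left this hc
    linarith
  have hexp : Real.exp 1 ≤ 3 := Real.exp_one_lt_three.le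
  have hsmall : 2 / R * (A / c) * t * 3 ≤ 1 / 2 := by
    rw [show 2 / R * (A / c) * t * 3 = (6 * A * t) / (R * c) by ring,
      div_le_iff₀ (by positivity)]
    nlinarith [mul_nonneg ht hA0, mul_nonneg ht hc.le]
  have hbound : ∀ k : ℕ, 0 < k → |g (q + t • e)| ≤ M * (1 / 2) ^ k := by
    intro k hk
    refine (key k hk ht2).trans ?_
    have h1 : (k : ℝ) ^ k / k.factorial ≤ 3 ^ k := by
      refine (Real.pow_div_factorial_le_exp _ (Nat.cast_nonneg k) k).trans ?_
      rw [← mul_one (k : ℝ), Real.exp_nat_mul]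
      gcongr
    calc _ = M * ((2 / R * (A / c) * t) ^ k * ((k : ℝ) ^ k / k.factorial)) := by
          rw [show 2 * (k : ℝ) / R * (A / c) = 2 / R * (A / c) * k by ring, mul_pow, mul_pow _ t]
          ring
      _ ≤ M * ((2 / R * (A / c) * t) ^ k * 3 ^ k) := by gcongr
      _ = M * (2 / R * (A / c) * t * 3) ^ k := by rw [mul_pow _ (3 : ℝ)]
      _ ≤ M * (1 / 2) ^ k := by gcongr
  have hlim : Tendsto (fun k : ℕ => M * (1 / 2 : ℝ) ^ k) atTop (𝓝 0) := by
    simpa using (tendsto_pow_atTop_nhds_zero_of_lt_one (r := (1 / 2 : ℝ)) (by norm_num)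
      (by norm_num)).const_mul M
  have := ge_of_tendsto hlim ((eventually_gt_atTop 0).mono hbound)
  exact abs_nonpos_iff.1 this

end Uniqueness

section MeanValue

open Filter Topology

lemma hasDerivAt_max_zero_pow (n : ℕ) (s : ℝ) :
    HasDerivAt (fun s : ℝ => max s 0 ^ (n + 2)) ((n + 2) * max s 0 ^ (n + 1)) s := by
  rcases lt_trichotomy s 0 with hs | rfl | hs
  · rw [max_eq_right hs.le]
    refine ((hasDerivAt_const s (0 : ℝ)).congr_of_eventuallyEq ?_).congr_deriv (by simp)
    filter_upwards [eventually_lt_nhds hs] with t ht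
    simp [max_eq_right ht.le]
  · rw [hasDerivAt_iff_isLittleO_nhds_zero]
    simp only [zero_add, max_self, ne_eq, Nat.add_eq_zero_iff, OfNat.ofNat_ne_zero, and_false,
      not_false_eq_true, zero_pow, sub_zero, one_ne_zero, mul_zero, smul_zero]
    have h1 : (fun h : ℝ => max h 0 ^ (n + 2)) =O[𝓝 0] fun h : ℝ => h ^ (n + 2) := by
      refine Asymptotics.IsBigO.of_bound 1 (Eventually.of_forall fun h => ?_)
      rw [one_mul, norm_pow, norm_pow]
      gcongr
      rw [Real.norm_of_nonneg (le_max_right _ _), Real.norm_eq_abs]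
      exact max_le (le_abs_self h) (abs_nonneg h)
    exact h1.trans_isLittleO (Asymptotics.isLittleO_pow_id (by omega))
  · rw [max_eq_left hs.le]
    have := (hasDerivAt_pow (n + 2) s)
    refine (this.congr_of_eventuallyEq ?_).congr_deriv (by push_cast; simp)
    filter_upwards [eventually_gt_nhds hs] with t ht
    simp [max_eq_left ht.le]

instance : (volume : Measure (ℝ × ℝ × ℝ)).IsAddHaarMeasure :=
  inferInstanceAs (((volume : Measure ℝ).prod (volume : Measure (ℝ × ℝ))).IsAddHaarMeasure)

lemma integral_add_add {α : Type*} [MeasurableSpace α] {μ : Measure α} {f g h : α → ℝ}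
    (hf : Integrable f μ) (hg : Integrable g μ) (hh : Integrable h μ) :
    ∫ y, (f y + g y + h y) ∂μ = ∫ y, f y ∂μ + ∫ y, g y ∂μ + ∫ y, h y ∂μ := by
  rw [← integral_add hf hg]
  exact integral_add (hf.add hg) hh

/-- The radial kernel `(1 - |y|²)₊ ^ n` on `ℝ³`. -/
noncomputable def radialKernel (n : ℕ) (y : ℝ × ℝ × ℝ) : ℝ :=
  max (1 - (y.1 ^ 2 + y.2.1 ^ 2 + y.2.2 ^ 2)) 0 ^ n

lemma radialKernel_eq_zero {n : ℕ} (hn : n ≠ 0) {y : ℝ × ℝ × ℝ} (hy : 1 < ‖y‖) :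
    radialKernel n y = 0 := by
  have h : 1 ≤ y.1 ^ 2 + y.2.1 ^ 2 + y.2.2 ^ 2 := by
    simp only [Prod.norm_def, lt_max_iff, Real.norm_eq_abs] at hy
    rcases hy with h | h | h <;> have := (one_lt_sq_iff_one_lt_abs _).2 h <;>
      nlinarith [sq_nonneg y.1, sq_nonneg y.2.1, sq_nonneg y.2.2]
  rw [radialKernel, max_eq_right (by linarith), zero_pow hn]

lemma hasCompactSupport_radialKernel {n : ℕ} (hn : n ≠ 0) :
    HasCompactSupport (radialKernel n) :=
  HasCompactSupport.intro (isCompact_closedBall (0 : ℝ × ℝ × ℝ) 1) fun y hy =>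
    radialKernel_eq_zero hn (by simpa using hy)

lemma contDiff_radialKernel (n : ℕ) : ContDiff ℝ 1 (radialKernel (n + 2)) := by
  have h : ContDiff ℝ 1 (fun s : ℝ => max s 0 ^ (n + 2)) := by
    rw [contDiff_one_iff_deriv]
    refine ⟨fun s => (hasDerivAt_max_zero_pow n s).differentiableAt, ?_⟩
    rw [show deriv (fun s : ℝ => max s 0 ^ (n + 2)) = fun s : ℝ => (n + 2) * max s 0 ^ (n + 1) from
      funext fun s => (hasDerivAt_max_zero_pow n s).deriv]
    fun_prop
  exact h.comp (g := fun s : ℝ => max s 0 ^ (n + 2))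
    (f := fun y : ℝ × ℝ × ℝ => 1 - (y.1 ^ 2 + y.2.1 ^ 2 + y.2.2 ^ 2)) (by fun_prop)

lemma fderiv_radialKernel (n : ℕ) (y v : ℝ × ℝ × ℝ) :
    fderiv ℝ (radialKernel (n + 2)) y v =
      -(2 * (n + 2)) * ((y.1 * v.1 + y.2.1 * v.2.1 + y.2.2 * v.2.2) * radialKernel (n + 1) y) := by
  have h1 : HasDerivAt (fun t : ℝ => 1 - ((y.1 + t * v.1) ^ 2 + (y.2.1 + t * v.2.1) ^ 2
      + (y.2.2 + t * v.2.2) ^ 2)) (-(2 * (y.1 * v.1 + y.2.1 * v.2.1 + y.2.2 * v.2.2))) 0 := by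
    have h : ∀ a b : ℝ, HasDerivAt (fun t : ℝ => (a + t * b) ^ 2) (2 * (a * b)) 0 := fun a b =>
      ((((hasDerivAt_id (0 : ℝ)).mul_const b).const_add a).pow 2).congr_deriv (by simp; ring)
    exact ((((h y.1 v.1).add (h y.2.1 v.2.1)).add (h y.2.2 v.2.2)).const_sub 1).congr_deriv
      (by ring)
  have h2 := (hasDerivAt_max_zero_pow n _).comp (0 : ℝ) h1
  have h3 : HasDerivAt (fun t : ℝ => y + t • v) v 0 := by
    simpa using ((hasDerivAt_id (0 : ℝ)).smul_const v).const_add y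
  have h4 := ((contDiff_radialKernel n).differentiable one_ne_zero
    (y + (0 : ℝ) • v)).hasFDerivAt.comp_hasDerivAt (0 : ℝ) h3
  rw [zero_smul, add_zero] at h4
  rw [h4.unique h2]
  simp only [radialKernel, zero_mul, add_zero]
  ring

lemma integral_radialKernel_pos {n : ℕ} : 0 < ∫ y, radialKernel (n + 2) y :=
  (contDiff_radialKernel n).continuous.integral_pos_of_hasCompactSupport_nonneg_nonzero
    (hasCompactSupport_radialKernel (by omega)) (fun y => by
      simp only [radialKernel, Pi.zero_apply]; positivity) (x := 0) (by simp [radialKernel])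

lemma integral_fderiv_mul_comp {E : Type*} [NormedAddCommGroup E] [NormedSpace ℝ E]
    [FiniteDimensional ℝ E] [MeasurableSpace E] [BorelSpace E] {μ : Measure E}
    [μ.IsAddHaarMeasure] {Ψ f : E → ℝ} (hΨ : ContDiff ℝ 1 Ψ) (hc : HasCompactSupport Ψ)
    (hf : ContDiff ℝ 1 f) (x e : E) (s : ℝ) :
    ∫ y, fderiv ℝ Ψ y e * f (x - s • y) ∂μ = s * ∫ y, Ψ y * fderiv ℝ f (x - s • y) e ∂μ := by
  have hd : ∀ y, fderiv ℝ (fun y => f (x - s • y)) y e = -s * fderiv ℝ f (x - s • y) e := by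
    intro y
    have h1 : HasFDerivAt (fun y : E => x - s • y) (-(s • ContinuousLinearMap.id ℝ E)) y :=
      ((hasFDerivAt_id y).const_smul s).const_sub x
    have h2 := ((hf.differentiable one_ne_zero (x - s • y)).hasFDerivAt.comp y h1).fderiv
    rw [show (fun y => f (x - s • y)) = f ∘ fun y => x - s • y from rfl, h2]
    simp
  have hf' : Continuous fun y => f (x - s • y) := hf.continuous.comp (by fun_prop)
  have hf'' : Continuous fun y => fderiv ℝ f (x - s • y) e :=
    ((hf.continuous_fderiv one_ne_zero).comp (by fun_prop)).clm_apply continuous_const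
  have hΨ' : Continuous fun y => fderiv ℝ Ψ y e :=
    (hΨ.continuous_fderiv one_ne_zero).clm_apply continuous_const
  have := integral_mul_fderiv_eq_neg_fderiv_mul_of_integrable (μ := μ) (v := e) (f := Ψ)
    (g := fun y => f (x - s • y))
    ((hΨ'.mul hf').integrable_of_hasCompactSupport (hc.fderiv_apply ℝ e).mul_right)
    (by
      simp only [hd]
      exact (hΨ.continuous.mul (continuous_const.mul hf'')).integrable_of_hasCompactSupport
        hc.mul_right)
    ((hΨ.continuous.mul hf').integrable_of_hasCompactSupport hc.mul_right)
    (fun y _ => hΨ.differentiable one_ne_zero y)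
    (fun y _ => (hf.differentiable one_ne_zero _).comp y (by fun_prop))
  rw [← neg_eq_iff_eq_neg] at this
  rw [← this, ← integral_neg, ← integral_const_mul]
  congr 1; ext y
  rw [hd]; ring

lemma fderiv_apply_eq (f : ℝ × ℝ × ℝ → ℝ) (z y : ℝ × ℝ × ℝ) :
    fderiv ℝ f z y = y.1 * fderiv ℝ f z (1, 0, 0) + y.2.1 * fderiv ℝ f z (0, 1, 0)
      + y.2.2 * fderiv ℝ f z (0, 0, 1) := by
  conv_lhs => rw [show y = y.1 • (1, 0, 0) + y.2.1 • (0, 1, 0) + y.2.2 • (0, 0, 1) by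
    ext <;> simp]
  simp only [map_add, map_smul, smul_eq_mul]

lemma hasDerivAt_kernelAverage_scale {E : Type*} [NormedAddCommGroup E] [NormedSpace ℝ E]
    [FiniteDimensional ℝ E] [MeasurableSpace E] [BorelSpace E] {μ : Measure E}
    [μ.IsAddHaarMeasure] {φ W : E → ℝ} (hφ : Continuous φ) (hc : HasCompactSupport φ)
    (hW : ContDiff ℝ 1 W) (hWc : HasCompactSupport W) (x : E) (s : ℝ) :
    HasDerivAt (fun s => kernelAverage μ φ s W x)
      (∫ y, φ y * -fderiv ℝ W (x - s • y) y ∂μ) s := by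
  have hW' := hW.continuous_fderiv one_ne_zero
  obtain ⟨C, hC⟩ := (hWc.fderiv ℝ).exists_bound_of_continuous hW'
  refine (hasDerivAt_integral_of_dominated_loc_of_deriv_le
    (F := fun s y => φ y * W (x - s • y)) (F' := fun s y => φ y * -fderiv ℝ W (x - s • y) y)
    (bound := fun y => |φ y| * (C * ‖y‖)) (s := univ) univ_mem
    (Eventually.of_forall fun s => ?_) ?_ ?_ (ae_of_all _ fun y s _ => ?_) ?_
    (ae_of_all _ fun y s _ => ?_)).2
  · exact (hφ.mul (hW.continuous.comp (by fun_prop))).aestronglyMeasurable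
  · exact (hφ.mul (hW.continuous.comp (by fun_prop))).integrable_of_hasCompactSupport hc.mul_right
  · exact (hφ.mul ((hW'.comp (by fun_prop)).clm_apply continuous_id).neg).aestronglyMeasurable
  · rw [norm_mul, Real.norm_eq_abs, norm_neg]
    gcongr
    exact ((fderiv ℝ W (x - s • y)).le_opNorm y).trans (by gcongr; exact hC _)
  · refine (hφ.abs.mul (by fun_prop)).integrable_of_hasCompactSupport ?_
    exact HasCompactSupport.mul_right (f := fun y => |φ y|) hc.norm
  · have h1 : HasDerivAt (fun s : ℝ => x - s • y) (-y) s := by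
      simpa using ((hasDerivAt_id s).smul_const y).const_sub x
    have h2 := (hW.differentiable one_ne_zero (x - s • y)).hasFDerivAt.comp_hasDerivAt s h1
    simpa using h2.const_mul (φ y)

/-- Mean value property of harmonic functions, for a radial kernel. -/
lemma kernelAverage_eq_of_harmonic {W : ℝ × ℝ × ℝ → ℝ} (hW : ContDiff ℝ 2 W)
    (hWc : HasCompactSupport W) {x : ℝ × ℝ × ℝ} {r : ℝ} (hr : 0 < r)
    (hΔ : ∀ z ∈ closedBall x r,
      d2₃ W (1, 0, 0) z + d2₃ W (0, 1, 0) z + d2₃ W (0, 0, 1) z = 0) :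
    kernelAverage volume (radialKernel 2) r W x = (∫ y, radialKernel 2 y) * W x := by
  have hW1 : ContDiff ℝ 1 W := hW.of_le (by norm_num)
  have hd := hasDerivAt_kernelAverage_scale (μ := volume) (contDiff_radialKernel 0).continuous
    (hasCompactSupport_radialKernel (n := 0 + 2) (by omega)) hW1 hWc x
  have hpart : ∀ e, ContDiff ℝ 1 fun z => fderiv ℝ W z e := fun e =>
    (hW.fderiv_right (m := 1) (by norm_num)).clm_apply contDiff_const
  have hi : ∀ (s : ℝ) (e : ℝ × ℝ × ℝ),
      Integrable fun y => fderiv ℝ (radialKernel 3) y e * fderiv ℝ W (x - s • y) e := by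
    intro s e
    refine Continuous.integrable_of_hasCompactSupport ?_
      ((hasCompactSupport_radialKernel (n := 3) (by omega)).fderiv_apply ℝ e).mul_right
    exact (((contDiff_radialKernel 1).continuous_fderiv one_ne_zero).clm_apply
      continuous_const).mul ((hpart e).continuous.comp (by fun_prop))
  have hj : ∀ (s : ℝ) (e : ℝ × ℝ × ℝ),
      Integrable fun y => radialKernel 3 y * d2₃ W e (x - s • y) := by
    intro s e
    refine Continuous.integrable_of_hasCompactSupport ?_
      (hasCompactSupport_radialKernel (n := 3) (by omega)).mul_right
    refine (contDiff_radialKernel 1).continuous.mul ?_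
    exact (((hpart e).continuous_fderiv one_ne_zero).comp (by fun_prop)).clm_apply
      continuous_const
  have hzero : ∀ s ∈ Icc 0 r,
      ∫ y, radialKernel 2 y * -fderiv ℝ W (x - s • y) y = 0 := by
    intro s hs
    have h1 : ∀ y, radialKernel 2 y * -fderiv ℝ W (x - s • y) y = 6⁻¹ *
        (fderiv ℝ (radialKernel 3) y (1, 0, 0) * fderiv ℝ W (x - s • y) (1, 0, 0)
        + fderiv ℝ (radialKernel 3) y (0, 1, 0) * fderiv ℝ W (x - s • y) (0, 1, 0)
        + fderiv ℝ (radialKernel 3) y (0, 0, 1) * fderiv ℝ W (x - s • y) (0, 0, 1)) := by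
      intro y
      rw [fderiv_apply_eq W _ y]
      simp only [fderiv_radialKernel 1]
      push_cast
      ring
    have hz : ∀ y, radialKernel 3 y * d2₃ W (1, 0, 0) (x - s • y)
        + radialKernel 3 y * d2₃ W (0, 1, 0) (x - s • y)
        + radialKernel 3 y * d2₃ W (0, 0, 1) (x - s • y) = 0 := by
      intro y
      rw [← mul_add, ← mul_add]
      by_cases hy : 1 < ‖y‖
      · rw [radialKernel_eq_zero (by omega) hy, zero_mul]
      · rw [hΔ, mul_zero]
        rw [mem_closedBall, dist_eq_norm, sub_sub_cancel_left, norm_neg, norm_smul,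
          Real.norm_of_nonneg hs.1]
        exact (mul_le_of_le_one_right hs.1 (not_lt.1 hy)).trans hs.2
    have hibp : ∀ e, ∫ y, fderiv ℝ (radialKernel 3) y e * fderiv ℝ W (x - s • y) e =
        s * ∫ y, radialKernel 3 y * d2₃ W e (x - s • y) := fun e =>
      integral_fderiv_mul_comp (contDiff_radialKernel 1)
        (hasCompactSupport_radialKernel (n := 3) (by omega)) (hpart e) x e s
    simp only [h1]
    rw [integral_const_mul, integral_add_add (hi s _) (hi s _) (hi s _), hibp, hibp, hibp,
      ← mul_add, ← mul_add, ← integral_add_add (hj s _) (hj s _) (hj s _)]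
    simp [hz]
  have hconst := constant_of_has_deriv_right_zero (a := 0) (b := r)
    (f := fun s => kernelAverage volume (radialKernel 2) s W x)
    (fun s _ => (hd s).continuousAt.continuousWithinAt)
    (fun s hs => ((hd s).congr_deriv (hzero s (Ico_subset_Icc_self hs))).hasDerivWithinAt)
    r ⟨hr.le, le_rfl⟩
  rw [hconst]
  simp [kernelAverage, integral_mul_const]

end MeanValue

section Gluing

open Filter Topology

variable {E F : Type*} [NormedAddCommGroup E] [NormedSpace ℝ E] [NormedAddCommGroup F]
  [NormedSpace ℝ F] {S U V : Set E} {h : E → F}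

lemma hasFDerivAt_indicator {h' : E → E →L[ℝ] F} {x : E}
    (hd : x ∈ closure S → HasFDerivAt h (h' x) x)
    (hfr : x ∈ frontier S → h x = 0 ∧ h' x = 0) :
    HasFDerivAt (S.indicator h) (S.indicator h' x) x := by
  classical
  by_cases hx : x ∈ frontier S
  · obtain ⟨h0, h1⟩ := hfr hx
    have h2 := hd hx.1
    rw [h1, hasFDerivAt_iff_isLittleO_nhds_zero] at h2
    have h3 : S.indicator h x = 0 := by
      rw [Set.indicator_apply, h0, ite_self]
    have h4 : S.indicator h' x = 0 := by
      rw [Set.indicator_apply, h1, ite_self]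
    rw [h4, hasFDerivAt_iff_isLittleO_nhds_zero]
    simp only [h0, h3, sub_zero, zero_apply] at h2 ⊢
    refine Asymptotics.IsBigO.trans_isLittleO ?_ h2
    exact Asymptotics.IsBigO.of_bound 1 (Eventually.of_forall fun v => by
      rw [one_mul]; exact norm_indicator_le_norm_self _ _)
  · by_cases hxS : x ∈ S
    · have hint : S ∈ 𝓝 x := by
        by_contra hcon
        exact hx ⟨subset_closure hxS, fun hi => hcon (mem_interior_iff_mem_nhds.1 hi)⟩
      rw [Set.indicator_of_mem hxS]
      refine (hd (subset_closure hxS)).congr_of_eventuallyEq ?_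
      filter_upwards [hint] with y hy using Set.indicator_of_mem hy h
    · have hint : Sᶜ ∈ 𝓝 x := by
        have : x ∉ closure S := fun hcl => hx ⟨hcl, fun hi => hxS (interior_subset hi)⟩
        exact mem_of_superset (isClosed_closure.isOpen_compl.mem_nhds this)
          (compl_subset_compl.2 subset_closure)
      rw [Set.indicator_of_notMem hxS]
      refine (hasFDerivAt_const (0 : F) x).congr_of_eventuallyEq ?_
      filter_upwards [hint] with y hy using Set.indicator_of_notMem hy h

lemma continuousOn_indicator_of_frontier {E F : Type*} [TopologicalSpace E]
    [NormedAddCommGroup F] {S U V : Set E} {h : E → F} (hU : IsOpen U) (hVU : V ∩ closure S ⊆ U)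
    (hh : ContinuousOn h U) (h0 : ∀ x ∈ V ∩ frontier S, h x = 0) :
    ContinuousOn (S.indicator h) V := by
  intro x hxV
  refine ContinuousAt.continuousWithinAt ?_
  by_cases hcl : x ∈ closure S
  · have hc : ContinuousAt h x := hh.continuousAt (hU.mem_nhds (hVU ⟨hxV, hcl⟩))
    by_cases hint : x ∈ interior S
    · refine hc.congr ?_
      filter_upwards [mem_interior_iff_mem_nhds.1 hint] with y hy
      exact (Set.indicator_of_mem hy h).symm
    · have hx0 := h0 x ⟨hxV, hcl, hint⟩
      have hx0' : S.indicator h x = 0 := by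
        simp [hx0]
      rw [ContinuousAt, hx0] at hc
      rw [ContinuousAt, hx0']
      exact squeeze_zero_norm (fun y => norm_indicator_le_norm_self h y) (by simpa using hc.norm)
  · refine continuousAt_const.congr (f := fun _ => (0 : F)) ?_
    filter_upwards [isClosed_closure.isOpen_compl.mem_nhds hcl] with y hy
    exact (Set.indicator_of_notMem (fun hyS => hy (subset_closure hyS)) h).symm

lemma hasFDerivAt_indicator_of_frontier (hU : IsOpen U) (hVU : V ∩ closure S ⊆ U)
    (hh : DifferentiableOn ℝ h U) (h0 : ∀ x ∈ V ∩ frontier S, h x = 0)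
    (h1 : ∀ x ∈ V ∩ frontier S, fderiv ℝ h x = 0) {x : E} (hx : x ∈ V) :
    HasFDerivAt (S.indicator h) (S.indicator (fderiv ℝ h) x) x :=
  hasFDerivAt_indicator
    (fun hcl => (hh.differentiableAt (hU.mem_nhds (hVU ⟨hx, hcl⟩))).hasFDerivAt)
    (fun hfr => ⟨h0 x ⟨hx, hfr⟩, h1 x ⟨hx, hfr⟩⟩)

lemma contDiffOn_one_indicator (hU : IsOpen U) (hV : IsOpen V) (hVU : V ∩ closure S ⊆ U)
    (hh : ContDiffOn ℝ 1 h U) (h0 : ∀ x ∈ V ∩ frontier S, h x = 0)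
    (h1 : ∀ x ∈ V ∩ frontier S, fderiv ℝ h x = 0) :
    ContDiffOn ℝ 1 (S.indicator h) V := by
  have hd := fun x hx => hasFDerivAt_indicator_of_frontier hU hVU (hh.differentiableOn one_ne_zero) h0 h1 (x := x) hx
  rw [show (1 : WithTop ℕ∞) = 0 + 1 from rfl, contDiffOn_succ_iff_fderiv_of_isOpen hV]
  refine ⟨fun x hx => (hd x hx).differentiableAt.differentiableWithinAt, by simp, ?_⟩
  rw [contDiffOn_zero]
  exact (continuousOn_indicator_of_frontier hU hVU (hh.continuousOn_fderiv_of_isOpen hU le_rfl) h1).congr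
    fun x hx => (hd x hx).fderiv

lemma contDiffOn_two_indicator (hU : IsOpen U) (hV : IsOpen V) (hVU : V ∩ closure S ⊆ U)
    (hh : ContDiffOn ℝ 2 h U) (h0 : ∀ x ∈ V ∩ frontier S, h x = 0)
    (h1 : ∀ x ∈ V ∩ frontier S, fderiv ℝ h x = 0)
    (h2 : ∀ x ∈ V ∩ frontier S, fderiv ℝ (fderiv ℝ h) x = 0) :
    ContDiffOn ℝ 2 (S.indicator h) V := by
  have hd := fun x hx => hasFDerivAt_indicator_of_frontier hU hVU (hh.differentiableOn two_ne_zero) h0 h1 (x := x) hx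
  rw [show (2 : WithTop ℕ∞) = 1 + 1 by norm_num, contDiffOn_succ_iff_fderiv_of_isOpen hV]
  refine ⟨fun x hx => (hd x hx).differentiableAt.differentiableWithinAt, by simp, ?_⟩
  exact (contDiffOn_one_indicator hU hV hVU (hh.fderiv_of_isOpen hU (by norm_num)) h1 h2).congr
    fun x hx => (hd x hx).fderiv

lemma fderiv_fderiv_indicator (hU : IsOpen U) (hV : IsOpen V) (hVU : V ∩ closure S ⊆ U)
    (hh : ContDiffOn ℝ 2 h U) (h0 : ∀ x ∈ V ∩ frontier S, h x = 0)
    (h1 : ∀ x ∈ V ∩ frontier S, fderiv ℝ h x = 0)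
    (h2 : ∀ x ∈ V ∩ frontier S, fderiv ℝ (fderiv ℝ h) x = 0) {x : E} (hx : x ∈ V) :
    fderiv ℝ (fderiv ℝ (S.indicator h)) x = S.indicator (fderiv ℝ (fderiv ℝ h)) x := by
  have hev : fderiv ℝ (S.indicator h) =ᶠ[𝓝 x] S.indicator (fderiv ℝ h) := by
    filter_upwards [hV.mem_nhds hx] with y hy
    exact (hasFDerivAt_indicator_of_frontier hU hVU (hh.differentiableOn two_ne_zero) h0 h1 hy).fderiv
  rw [hev.fderiv_eq]
  exact (hasFDerivAt_indicator_of_frontier hU hVU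
    ((hh.fderiv_of_isOpen (m := 1) hU (by norm_num)).differentiableOn one_ne_zero) h1 h2 hx).fderiv

end Gluing

section Face

open Filter Topology

lemma eq_zero_of_forall_above {F : Type*} [NormedAddCommGroup F] {f : ℝ × ℝ × ℝ → F}
    {p : ℝ × ℝ × ℝ} {l : ℝ} (hl : 0 < l) (hp : p.2.2 = 0) (hf : ContinuousAt f p)
    (h : ∀ z ∈ Ioo 0 l, f (p.1, p.2.1, z) = 0) : f p = 0 := by
  have h1 : Tendsto (fun z : ℝ => (p.1, p.2.1, z)) (𝓝[>] 0) (𝓝 p) := by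
    have : Continuous fun z : ℝ => (p.1, p.2.1, z) := by fun_prop
    have h2 := this.tendsto 0
    rw [show (p.1, p.2.1, (0 : ℝ)) = p from Prod.ext rfl (Prod.ext rfl hp.symm)] at h2
    exact h2.mono_left nhdsWithin_le_nhds
  have h3 : (fun z : ℝ => f (p.1, p.2.1, z)) =ᶠ[𝓝[>] 0] fun _ => 0 := by
    filter_upwards [Ioo_mem_nhdsGT hl] with z hz using h z hz
  exact tendsto_nhds_unique (hf.tendsto.comp h1) (tendsto_const_nhds.congr' h3.symm)

lemma fderiv_eq_zero_of_face {F : Type*} [NormedAddCommGroup F] [NormedSpace ℝ F]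
    {f : ℝ × ℝ × ℝ → F} {Θ : Set (ℝ × ℝ)} (hΘ : IsOpen Θ) {p : ℝ × ℝ × ℝ}
    (hpΘ : (p.1, p.2.1) ∈ Θ) (hp : p.2.2 = 0) (hf : DifferentiableAt ℝ f p)
    (h : ∀ q : ℝ × ℝ × ℝ, (q.1, q.2.1) ∈ Θ → q.2.2 = 0 → f q = 0) {v : ℝ × ℝ × ℝ}
    (hv : v.2.2 = 0) : fderiv ℝ f p v = 0 := by
  have h1 : HasDerivAt (fun t : ℝ => p + t • v) v 0 := by
    simpa using ((hasDerivAt_id (0 : ℝ)).smul_const v).const_add p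
  have h2 : HasFDerivAt f (fderiv ℝ f p) (p + (0 : ℝ) • v) := by simpa using hf.hasFDerivAt
  refine (h2.comp_hasDerivAt (0 : ℝ) h1).unique
    ((hasDerivAt_const (0 : ℝ) (0 : F)).congr_of_eventuallyEq ?_)
  have hcont : Continuous fun t : ℝ => ((p + t • v).1, (p + t • v).2.1) := by fun_prop
  filter_upwards [hcont.continuousAt.preimage_mem_nhds
    (hΘ.mem_nhds (x := ((p + (0 : ℝ) • v).1, (p + (0 : ℝ) • v).2.1)) (by simpa using hpΘ))]
    with t ht
  exact h _ ht (by simp [hp, hv])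

lemma clm_eq_zero {F : Type*} [NormedAddCommGroup F] [NormedSpace ℝ F]
    {L : ℝ × ℝ × ℝ →L[ℝ] F} (h : ∀ v : ℝ × ℝ × ℝ, v.2.2 = 0 → L v = 0)
    (h3 : L (0, 0, 1) = 0) : L = 0 := by
  refine ContinuousLinearMap.ext fun v => ?_
  have : v = (v.1, v.2.1, 0) + v.2.2 • (0, 0, 1) := by ext <;> simp
  rw [this, map_add, map_smul, h3, h _ rfl]
  simp

lemma d2₃_eq {f : ℝ × ℝ × ℝ → ℝ} {p : ℝ × ℝ × ℝ} (hf : DifferentiableAt ℝ (fderiv ℝ f) p)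
    (v : ℝ × ℝ × ℝ) : d2₃ f v p = fderiv ℝ (fderiv ℝ f) p v v := by
  rw [d2₃, fderiv_clm_apply hf (by fun_prop)]
  simp

lemma fderiv_and_fderiv_fderiv_eq_zero_of_face {Θ : Set (ℝ × ℝ)} (hΘ : IsOpen Θ) {l : ℝ}
    (hl : 0 < l) {u1 u2 u3 : ℝ × ℝ × ℝ → ℝ} {U : Set (ℝ × ℝ × ℝ)} (hU : IsOpen U)
    (hUΘ : ∀ q : ℝ × ℝ × ℝ, (q.1, q.2.1) ∈ Θ → q.2.2 = 0 → q ∈ U)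
    (h1 : ContDiffOn ℝ 2 u1 U) (h2 : ContDiffOn ℝ 2 u2 U) (h3 : ContDiffOn ℝ 2 u3 U)
    (hUP : ∀ q : ℝ × ℝ × ℝ, (q.1, q.2.1) ∈ Θ → q.2.2 ∈ Ioo 0 l → q ∈ U)
    (hharm : ∀ q : ℝ × ℝ × ℝ, (q.1, q.2.1) ∈ Θ → q.2.2 ∈ Ioo 0 l →
      d2₃ u3 (1, 0, 0) q + d2₃ u3 (0, 1, 0) q + d2₃ u3 (0, 0, 1) q = 0)
    (hdiv : ∀ q : ℝ × ℝ × ℝ, (q.1, q.2.1) ∈ Θ → q.2.2 ∈ Ioo 0 l →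
      fderiv ℝ u1 q (1, 0, 0) + fderiv ℝ u2 q (0, 1, 0) + fderiv ℝ u3 q (0, 0, 1) = 0)
    (hbot : ∀ q : ℝ × ℝ × ℝ, (q.1, q.2.1) ∈ Θ → q.2.2 = 0 → u1 q = 0 ∧ u2 q = 0 ∧ u3 q = 0) :
    ∀ q : ℝ × ℝ × ℝ, (q.1, q.2.1) ∈ Θ → q.2.2 = 0 →
      fderiv ℝ u3 q = 0 ∧ fderiv ℝ (fderiv ℝ u3) q = 0 := by
  have hdiff : ∀ {u : ℝ × ℝ × ℝ → ℝ}, ContDiffOn ℝ 2 u U → ∀ q ∈ U, DifferentiableAt ℝ u q :=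
    fun hu q hq => (hu.differentiableOn two_ne_zero).differentiableAt (hU.mem_nhds hq)
  have hcont : ∀ {u : ℝ × ℝ × ℝ → ℝ}, ContDiffOn ℝ 2 u U → ∀ q ∈ U,
      ContinuousAt (fderiv ℝ u) q :=
    fun hu q hq => (hu.continuousOn_fderiv_of_isOpen hU one_le_two).continuousAt (hU.mem_nhds hq)
  have hd3 : ContDiffOn ℝ 1 (fderiv ℝ u3) U := h3.fderiv_of_isOpen hU (by norm_num)
  have hdiff3 : ∀ q ∈ U, DifferentiableAt ℝ (fderiv ℝ u3) q := fun q hq =>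
    (hd3.differentiableOn one_ne_zero).differentiableAt (hU.mem_nhds hq)
  have hface1 : ∀ q : ℝ × ℝ × ℝ, (q.1, q.2.1) ∈ Θ → q.2.2 = 0 → fderiv ℝ u3 q = 0 := by
    intro q hqΘ hq
    have hqU := hUΘ q hqΘ hq
    refine clm_eq_zero (fun v hv => fderiv_eq_zero_of_face hΘ hqΘ hq (hdiff h3 q hqU)
      (fun b hb hb0 => (hbot b hb hb0).2.2) hv) ?_
    have hlim := eq_zero_of_forall_above (f := fun b => fderiv ℝ u1 b (1, 0, 0) +
      fderiv ℝ u2 b (0, 1, 0) + fderiv ℝ u3 b (0, 0, 1)) hl hq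
      ((((hcont h1 q hqU).clm_apply continuousAt_const).add
        ((hcont h2 q hqU).clm_apply continuousAt_const)).add
        ((hcont h3 q hqU).clm_apply continuousAt_const)) (fun z hz => hdiv _ hqΘ hz)
    have e1 : fderiv ℝ u1 q (1, 0, 0) = 0 := fderiv_eq_zero_of_face hΘ hqΘ hq (hdiff h1 q hqU)
      (fun b hb hb0 => (hbot b hb hb0).1) rfl
    have e2 : fderiv ℝ u2 q (0, 1, 0) = 0 := fderiv_eq_zero_of_face hΘ hqΘ hq (hdiff h2 q hqU)
      (fun b hb hb0 => (hbot b hb hb0).2.1) rfl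
    simpa [e1, e2] using hlim
  refine fun q hqΘ hq => ⟨hface1 q hqΘ hq, ?_⟩
  have hqU := hUΘ q hqΘ hq
  have htan : ∀ v : ℝ × ℝ × ℝ, v.2.2 = 0 → fderiv ℝ (fderiv ℝ u3) q v = 0 := fun v hv =>
    fderiv_eq_zero_of_face hΘ hqΘ hq (hdiff3 q hqU) hface1 hv
  refine clm_eq_zero htan (clm_eq_zero (fun v hv => ?_) ?_)
  · have hsymm : IsSymmSndFDerivAt ℝ u3 q :=
      (h3.contDiffAt (hU.mem_nhds hqU)).isSymmSndFDerivAt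
        (by simp [minSmoothness_of_isRCLikeNormedField])
    rw [hsymm.eq, htan v hv]
    rfl
  · have hD : ContinuousAt (fderiv ℝ (fderiv ℝ u3)) q :=
      (hd3.continuousOn_fderiv_of_isOpen hU le_rfl).continuousAt (hU.mem_nhds hqU)
    have hDv : ∀ v, ContinuousAt (fun b => fderiv ℝ (fderiv ℝ u3) b v v) q := fun v =>
      (hD.clm_apply continuousAt_const).clm_apply continuousAt_const
    have hlim := eq_zero_of_forall_above (f := fun b =>
      fderiv ℝ (fderiv ℝ u3) b (1, 0, 0) (1, 0, 0) + fderiv ℝ (fderiv ℝ u3) b (0, 1, 0) (0, 1, 0) +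
      fderiv ℝ (fderiv ℝ u3) b (0, 0, 1) (0, 0, 1)) hl hq
      (((hDv _).add (hDv _)).add (hDv _)) (fun z hz => by
        have := hharm (q.1, q.2.1, z) hqΘ hz
        simpa only [d2₃_eq (hdiff3 _ (hUP (q.1, q.2.1, z) hqΘ hz))] using this)
    simpa [htan] using hlim

end Face

section Continuation

open Filter Topology

lemma exists_eq_zero_of_harmonic : ∃ κ : ℝ, 0 < κ ∧ κ ≤ 1 / 12 ∧
    ∀ {w : ℝ × ℝ × ℝ → ℝ} {V : Set (ℝ × ℝ × ℝ)} {q : ℝ × ℝ × ℝ} {R t : ℝ}, IsOpen V →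
      ContDiffOn ℝ 2 w V → 0 < R → closedBall q (2 * R) ⊆ V →
      (∀ z ∈ V, d2₃ w (1, 0, 0) z + d2₃ w (0, 1, 0) z + d2₃ w (0, 0, 1) z = 0) →
      (∀ᶠ x in 𝓝 q, w x = 0) → 0 ≤ t → t ≤ κ * R → w (q + t • (0, 0, 1)) = 0 := by
  have hc : 0 < ∫ y, radialKernel 2 y := integral_radialKernel_pos
  set c := ∫ y, radialKernel 2 y with hcdef
  set A := ∫ y : ℝ × ℝ × ℝ, |fderiv ℝ (radialKernel 2) y (0, 0, 1)| with hA
  have hA0 : 0 ≤ A := integral_nonneg fun _ => abs_nonneg _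
  have hκ : c / (12 * (A + c)) ≤ 1 / 12 := by
    rw [div_le_div_iff₀ (by positivity) (by norm_num)]
    linarith
  refine ⟨c / (12 * (A + c)), by positivity, hκ, ?_⟩
  intro w V q R t hV hw hR hqV hΔ hq ht htR
  let χ : ContDiffBump q := ⟨R, 2 * R, hR, by linarith⟩
  set W : ℝ × ℝ × ℝ → ℝ := fun x => χ x * w x with hWdef
  have hsupp : tsupport χ ⊆ V := by rw [χ.tsupport_eq]; exact hqV
  have hW : ContDiff ℝ 2 W := by
    rw [contDiff_iff_contDiffAt]
    intro x
    by_cases hx : x ∈ tsupport χ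
    · exact χ.contDiff.contDiffAt.mul (hw.contDiffAt (hV.mem_nhds (hsupp hx)))
    · have h1 := notMem_tsupport_iff_eventuallyEq.1 hx
      refine (contDiffAt_const (c := (0 : ℝ))).congr_of_eventuallyEq ?_
      filter_upwards [h1] with y hy
      simp [hWdef, hy]
  have hWc : HasCompactSupport W := χ.hasCompactSupport.mul_right
  obtain ⟨M, hM⟩ := hWc.exists_bound_of_continuous hW.continuous
  have hWw : ∀ x ∈ ball q R, W =ᶠ[𝓝 x] w := by
    intro x hx
    filter_upwards [isOpen_ball.mem_nhds hx] with y hy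
    simp [hWdef, χ.one_of_mem_closedBall (ball_subset_closedBall hy)]
  have hd2 : ∀ x ∈ ball q R, ∀ v, d2₃ W v x = d2₃ w v x := by
    intro x hx v
    have hev : (fun y => fderiv ℝ W y v) =ᶠ[𝓝 x] fun y => fderiv ℝ w y v := by
      filter_upwards [(hWw x hx).eventually_nhds] with y hy
      rw [Filter.EventuallyEq.fderiv_eq hy]
    rw [d2₃, d2₃, hev.fderiv_eq]
  have hsub : ball q R ⊆ V :=
    (ball_subset_closedBall.trans (closedBall_subset_closedBall (by linarith))).trans hqV
  have htR' : t < R := by nlinarith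
  have hmem : q + t • ((0, 0, 1) : ℝ × ℝ × ℝ) ∈ ball q R := by
    rw [mem_ball, dist_eq_norm, add_sub_cancel_left, norm_smul, Real.norm_of_nonneg ht]
    simpa [Prod.norm_def] using htR'
  rw [← (hWw _ hmem).self_of_nhds]
  refine eq_zero_of_kernelAverage_eq (μ := volume) (φ := radialKernel 2)
    (contDiff_radialKernel 0) (fun y hy => radialKernel_eq_zero two_ne_zero hy) hc
    (by simp [Prod.norm_def]) hW.continuous hM hR (fun x r hr hxr => ?_) ?_ ht htR
  · refine kernelAverage_eq_of_harmonic hW hWc hr fun z hz => ?_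
    simp only [hd2 z (hxr hz)]
    exact hΔ z (hsub (hxr hz))
  · filter_upwards [hq] with x hx
    simp [hWdef, hx]

lemma eq_zero_of_harmonic_of_eq_zero_below {w : ℝ × ℝ × ℝ → ℝ} {V : Set (ℝ × ℝ × ℝ)}
    (hV : IsOpen V) (hw : ContDiffOn ℝ 2 w V)
    (hΔ : ∀ z ∈ V, d2₃ w (1, 0, 0) z + d2₃ w (0, 1, 0) z + d2₃ w (0, 0, 1) z = 0)
    (h0 : ∀ q : ℝ × ℝ × ℝ, q.2.2 ≤ 0 → w q = 0) {x y s : ℝ}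
    (hseg : ∀ z ∈ Icc (-1) s, (x, y, z) ∈ V) : w (x, y, s) = 0 := by
  obtain ⟨κ, hκ0, hκ1, hκ⟩ := exists_eq_zero_of_harmonic
  have hcont : Continuous fun z : ℝ => (x, y, z) := by fun_prop
  obtain ⟨δ, hδ0, hδ⟩ := (isCompact_Icc.image hcont (s := Icc (-1) s)
    ).exists_cthickening_subset_open hV (image_subset_iff.2 hseg)
  set R := min (δ / 3) 1 with hRdef
  have hR : 0 < R := lt_min (by positivity) one_pos
  have hRδ : R ≤ δ / 3 := min_le_left _ _
  have hR1 : R ≤ 1 := min_le_right _ _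
  have hκR : 0 < κ * R := mul_pos hκ0 hR
  have hκR1 : κ * R ≤ 1 := by nlinarith
  have key : ∀ (n : ℕ) (q : ℝ × ℝ × ℝ), |q.1 - x| < R → |q.2.1 - y| < R → q.2.2 ≤ s →
      q.2.2 < n * (κ * R) → w q = 0 := by
    intro n
    induction n with
    | zero => exact fun q _ _ _ hq => h0 q (by simpa using hq.le)
    | succ n ih =>
      intro q hq1 hq2 hqs hqn
      rcases le_or_gt q.2.2 0 with hq0 | hq0
      · exact h0 q hq0
      push_cast at hqn
      have hshift : q = (q.1, q.2.1, q.2.2 - κ * R) + (κ * R) • (0, 0, 1) := by ext <;> simp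
      rw [hshift]
      refine hκ hV hw hR (fun b hb => hδ ?_) hΔ ?_ hκR.le le_rfl
      · refine mem_cthickening_of_dist_le b _ δ _
          (mem_image_of_mem _ (show q.2.2 - κ * R ∈ Icc (-1) s from ⟨?_, ?_⟩)) ?_
        · linarith
        · linarith
        · refine (dist_triangle b (q.1, q.2.1, q.2.2 - κ * R) _).trans ?_
          have h1 : dist (q.1, q.2.1, q.2.2 - κ * R) (x, y, q.2.2 - κ * R) ≤ R := by
            simp [Prod.dist_eq, Real.dist_eq, hq1.le, hq2.le]
          linarith [mem_closedBall.1 hb]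
      · have hopen : IsOpen {b : ℝ × ℝ × ℝ | |b.1 - x| < R ∧ |b.2.1 - y| < R ∧ b.2.2 < s ∧
            b.2.2 < n * (κ * R)} := by
          refine (isOpen_lt ?_ ?_).and ((isOpen_lt ?_ ?_).and
            ((isOpen_lt ?_ ?_).and (isOpen_lt ?_ ?_))) <;> fun_prop
        filter_upwards [hopen.mem_nhds (x := (q.1, q.2.1, q.2.2 - κ * R))
          ⟨hq1, hq2, show q.2.2 - κ * R < s by linarith,
            show q.2.2 - κ * R < n * (κ * R) by linarith⟩] with b hb
        exact ih b hb.1 hb.2.1 hb.2.2.1.le hb.2.2.2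
  obtain ⟨n, hn⟩ := exists_nat_gt (s / (κ * R))
  exact key n (x, y, s) (by simpa using hR) (by simpa using hR) le_rfl ((div_lt_iff₀ hκR).1 hn)

end Continuation

/-- Let `P = Θ × (0,l)` be a cylinder in `ℝ³` over a bounded planar domain `Θ`.
If `v = (u1, u2, u3)` is a harmonic, divergence-free vector field on `P`, smooth up
to the bottom face `Θ × {0}`, and `v = 0` on that bottom face, then `u3 ≡ 0` in `P`. -/
theorem stmt_5 (Θ : Set (ℝ × ℝ)) (hΘo : IsOpen Θ) (hΘb : Bornology.IsBounded Θ)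
    (l : ℝ) (hl : 0 < l)
    (u1 u2 u3 : ℝ × ℝ × ℝ → ℝ) (U : Set (ℝ × ℝ × ℝ)) (hU : IsOpen U)
    (hUP : {p : ℝ × ℝ × ℝ | (p.1, p.2.1) ∈ Θ ∧ p.2.2 ∈ Ioo 0 l} ∪
           {p : ℝ × ℝ × ℝ | (p.1, p.2.1) ∈ Θ ∧ p.2.2 = 0} ⊆ U)
    (hsm1 : ContDiffOn ℝ 2 u1 U) (hsm2 : ContDiffOn ℝ 2 u2 U)
    (hsm3 : ContDiffOn ℝ 2 u3 U)
    (hharm1 : ∀ p ∈ {p : ℝ × ℝ × ℝ | (p.1, p.2.1) ∈ Θ ∧ p.2.2 ∈ Ioo 0 l},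
      d2₃ u1 (1, 0, 0) p + d2₃ u1 (0, 1, 0) p + d2₃ u1 (0, 0, 1) p = 0)
    (hharm2 : ∀ p ∈ {p : ℝ × ℝ × ℝ | (p.1, p.2.1) ∈ Θ ∧ p.2.2 ∈ Ioo 0 l},
      d2₃ u2 (1, 0, 0) p + d2₃ u2 (0, 1, 0) p + d2₃ u2 (0, 0, 1) p = 0)
    (hharm3 : ∀ p ∈ {p : ℝ × ℝ × ℝ | (p.1, p.2.1) ∈ Θ ∧ p.2.2 ∈ Ioo 0 l},
      d2₃ u3 (1, 0, 0) p + d2₃ u3 (0, 1, 0) p + d2₃ u3 (0, 0, 1) p = 0)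
    (hdiv : ∀ p ∈ {p : ℝ × ℝ × ℝ | (p.1, p.2.1) ∈ Θ ∧ p.2.2 ∈ Ioo 0 l},
      fderiv ℝ u1 p (1, 0, 0) + fderiv ℝ u2 p (0, 1, 0) + fderiv ℝ u3 p (0, 0, 1) = 0)
    (hbottom : ∀ p ∈ {p : ℝ × ℝ × ℝ | (p.1, p.2.1) ∈ Θ ∧ p.2.2 = 0},
      u1 p = 0 ∧ u2 p = 0 ∧ u3 p = 0) :
    ∀ p ∈ {p : ℝ × ℝ × ℝ | (p.1, p.2.1) ∈ Θ ∧ p.2.2 ∈ Ioo 0 l}, u3 p = 0 := by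
  have hU0 : ∀ q : ℝ × ℝ × ℝ, (q.1, q.2.1) ∈ Θ → q.2.2 = 0 → q ∈ U := fun q h h' =>
    hUP (Or.inr ⟨h, h'⟩)
  have hUP' : ∀ q : ℝ × ℝ × ℝ, (q.1, q.2.1) ∈ Θ → q.2.2 ∈ Ioo 0 l → q ∈ U := fun q h h' =>
    hUP (Or.inl ⟨h, h'⟩)
  have hface := fderiv_and_fderiv_fderiv_eq_zero_of_face hΘo hl hU hU0 hsm1 hsm2 hsm3 hUP'
    (fun q h h' => hharm3 q ⟨h, h'⟩) (fun q h h' => hdiv q ⟨h, h'⟩) (fun q h h' => hbottom q ⟨h, h'⟩)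
  set S : Set (ℝ × ℝ × ℝ) := {q | 0 < q.2.2} with hS
  set V : Set (ℝ × ℝ × ℝ) := {q | (q.1, q.2.1) ∈ Θ ∧ q.2.2 < l} with hVdef
  have hz : Continuous fun q : ℝ × ℝ × ℝ => q.2.2 := by fun_prop
  have hV : IsOpen V :=
    (hΘo.preimage (by fun_prop : Continuous fun q : ℝ × ℝ × ℝ => (q.1, q.2.1))).inter
      (isOpen_lt hz continuous_const)
  have hSo : IsOpen S := isOpen_lt continuous_const hz
  have hScl : closure S ⊆ {q | 0 ≤ q.2.2} :=
    closure_minimal (fun q (hq : 0 < q.2.2) => hq.le) (isClosed_le continuous_const hz)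
  have hSfr : ∀ q ∈ frontier S, q.2.2 = 0 := by
    intro q hq
    rw [hSo.frontier_eq] at hq
    exact le_antisymm (not_lt.1 hq.2) (hScl hq.1)
  have hVU : V ∩ closure S ⊆ U := by
    rintro q ⟨hqV, hqS⟩
    rcases (show 0 ≤ q.2.2 from hScl hqS).eq_or_lt with h | h
    · exact hU0 q hqV.1 h.symm
    · exact hUP' q hqV.1 ⟨h, hqV.2⟩
  have h0 : ∀ q ∈ V ∩ frontier S, u3 q = 0 := fun q hq =>
    (hbottom q ⟨hq.1.1, hSfr q hq.2⟩).2.2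
  have h1 : ∀ q ∈ V ∩ frontier S, fderiv ℝ u3 q = 0 := fun q hq =>
    (hface q hq.1.1 (hSfr q hq.2)).1
  have h2 : ∀ q ∈ V ∩ frontier S, fderiv ℝ (fderiv ℝ u3) q = 0 := fun q hq =>
    (hface q hq.1.1 (hSfr q hq.2)).2
  have hw := contDiffOn_two_indicator hU hV hVU hsm3 h0 h1 h2
  have hdw : ∀ q ∈ V, DifferentiableAt ℝ (fderiv ℝ (S.indicator u3)) q := fun q hq =>
    ((hw.fderiv_of_isOpen (m := 1) hV (by norm_num)).differentiableOn
      one_ne_zero).differentiableAt (hV.mem_nhds hq)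
  have hdu : ∀ q ∈ U, DifferentiableAt ℝ (fderiv ℝ u3) q := fun q hq =>
    ((hsm3.fderiv_of_isOpen (m := 1) hU (by norm_num)).differentiableOn
      one_ne_zero).differentiableAt (hU.mem_nhds hq)
  rintro ⟨x, y, s⟩ ⟨hpΘ, hps⟩
  have hzero : S.indicator u3 (x, y, s) = 0 := by
    refine eq_zero_of_harmonic_of_eq_zero_below hV hw (fun q hq => ?_)
      (fun q hq => indicator_of_notMem (show q ∉ S from not_lt.2 hq) _) (fun z hz => ⟨hpΘ, hz.2.trans_lt hps.2⟩)
    simp only [d2₃_eq (hdw q hq), fderiv_fderiv_indicator hU hV hVU hsm3 h0 h1 h2 hq]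
    by_cases hqS : q ∈ S
    · have hqP := hharm3 q ⟨hq.1, hqS, hq.2⟩
      simpa only [indicator_of_mem hqS, d2₃_eq (hdu q (hUP' q hq.1 ⟨hqS, hq.2⟩))] using hqP
    · simp [indicator_of_notMem hqS]
  rwa [indicator_of_mem (show (x, y, s) ∈ S from hps.1)] at hzero
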